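/- arXiv:math/0109087 — 5 statements merged into one kernel-verified Lean document; each statement's English description precedes it below -/
import Mathlib

section
/- For every a, b, c ∈ ℤ, the three matrices M₁ = A, M₂ = (1−a, a²−abc, ac; −1, a−bc+1, c; −b, ab−b²c, bc+1), M₃ = (2−a, 1−2a+a²−abc+bc, ac−c; −1, a−bc, c; −b, ab−b−b²c, bc+1) all lie in SL(3,ℤ), are each conjugate in SL(3,ℤ) to A, and satisfy the Wirtinger relations M₂M₁ = M₁M₃ = M₃M₂. Consequently there is a group homomorphism ρ_{abc} from the trefoil group G to SL(3,ℤ) with ρ_{abc}(g₁) = M₁, ρ_{abc}(g₂) = M₂, ρ_{abc}(g₃) = M₃, and ρ_{abc} sends each of the generators g₁, g₂, g₃ into the conjugacy class of A. -/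
open Matrix

abbrev SL3 := Matrix.SpecialLinearGroup (Fin 3) ℤ

/-- The standard monodromy matrix `A = (1,1,0; 0,1,0; 0,0,1)`. -/
def Amat : Matrix (Fin 3) (Fin 3) ℤ := !![1, 1, 0; 0, 1, 0; 0, 0, 1]

/-- `M` is conjugate in `SL(3,ℤ)` to the matrix `A`. -/
def ConjToA (M : Matrix (Fin 3) (Fin 3) ℤ) : Prop :=
  ∃ P : SL3, ((P⁻¹ : SL3) : Matrix (Fin 3) (Fin 3) ℤ) * M *
    ((P : SL3) : Matrix (Fin 3) (Fin 3) ℤ) = Amat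

/-- The Wirtinger relations `g₂g₁ = g₁g₃` and `g₁g₃ = g₃g₂` of the trefoil knot group,
on generators `g₁ = 0`, `g₂ = 1`, `g₃ = 2`. -/
def trefoilRels : Set (FreeGroup (Fin 3)) :=
  {FreeGroup.of 1 * FreeGroup.of 0 * (FreeGroup.of 0 * FreeGroup.of 2)⁻¹,
   FreeGroup.of 0 * FreeGroup.of 2 * (FreeGroup.of 2 * FreeGroup.of 1)⁻¹}

/-- The trefoil group `G = ⟨g₁,g₂,g₃ | g₂g₁ = g₁g₃ = g₃g₂⟩`. -/
abbrev TrefoilGroup := PresentedGroup trefoilRels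

/-- The matrix `ρ_{abc}(g₂)`. -/
def trefM₂ (a b c : ℤ) : Matrix (Fin 3) (Fin 3) ℤ :=
  !![1 - a, a ^ 2 - a * b * c, a * c;
     -1, a - b * c + 1, c;
     -b, a * b - b ^ 2 * c, b * c + 1]

/-- The matrix `ρ_{abc}(g₃)`. -/
def trefM₃ (a b c : ℤ) : Matrix (Fin 3) (Fin 3) ℤ :=
  !![2 - a, 1 - 2 * a + a ^ 2 - a * b * c + b * c, a * c - c;
     -1, a - b * c, c;
     -b, a * b - b - b ^ 2 * c, b * c + 1]

theorem ConjToA.of_mul_eq {M : Matrix (Fin 3) (Fin 3) ℤ} (P : SL3)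
    (h : M * (P : Matrix (Fin 3) (Fin 3) ℤ) = P * Amat) : ConjToA M := by
  refine ⟨P, ?_⟩
  rw [Matrix.mul_assoc, h, ← Matrix.mul_assoc, ← Matrix.SpecialLinearGroup.coe_mul,
    inv_mul_cancel, Matrix.SpecialLinearGroup.coe_one, Matrix.one_mul]

theorem det_Amat : Amat.det = 1 := by
  simp [Amat, Matrix.det_fin_three]

theorem det_trefM₂ (a b c : ℤ) : (trefM₂ a b c).det = 1 := by
  simp [trefM₂, Matrix.det_fin_three]
  ring

theorem det_trefM₃ (a b c : ℤ) : (trefM₃ a b c).det = 1 := by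
  simp [trefM₃, Matrix.det_fin_three]
  ring

theorem conjToA_Amat : ConjToA Amat :=
  .of_mul_eq 1 (by simp)

theorem conjToA_trefM₂ (a b c : ℤ) : ConjToA (trefM₂ a b c) := by
  refine .of_mul_eq ⟨!![a, -1, c; 1, 0, 0; b, 0, 1], by simp [Matrix.det_fin_three]⟩ ?_
  ext i j
  fin_cases i <;> fin_cases j <;>
    simp [trefM₂, Amat, Matrix.mul_apply, Fin.sum_univ_three] <;> ring

theorem conjToA_trefM₃ (a b c : ℤ) : ConjToA (trefM₃ a b c) := by
  refine .of_mul_eq ⟨!![a - 1, -1, c; 1, 0, 0; b, 0, 1], by simp [Matrix.det_fin_three]⟩ ?_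
  ext i j
  fin_cases i <;> fin_cases j <;>
    simp [trefM₃, Amat, Matrix.mul_apply, Fin.sum_univ_three] <;> ring

theorem trefM₂_mul_Amat (a b c : ℤ) : trefM₂ a b c * Amat = Amat * trefM₃ a b c := by
  ext i j
  fin_cases i <;> fin_cases j <;>
    simp [trefM₂, trefM₃, Amat, Matrix.mul_apply, Fin.sum_univ_three] <;> ring

theorem Amat_mul_trefM₃ (a b c : ℤ) :
    Amat * trefM₃ a b c = trefM₃ a b c * trefM₂ a b c := by
  ext i j
  fin_cases i <;> fin_cases j <;>
    simp [trefM₂, trefM₃, Amat, Matrix.mul_apply, Fin.sum_univ_three] <;> ring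

/-- The images in `SL(3,ℤ)` of the Wirtinger generators. -/
def trefoilGen (a b c : ℤ) : Fin 3 → SL3 :=
  ![⟨Amat, det_Amat⟩, ⟨trefM₂ a b c, det_trefM₂ a b c⟩, ⟨trefM₃ a b c, det_trefM₃ a b c⟩]

theorem lift_trefoilGen_eq_one (a b c : ℤ) :
    ∀ r ∈ trefoilRels, FreeGroup.lift (trefoilGen a b c) r = 1 := by
  rintro r (rfl | rfl) <;>
    simp only [map_mul, map_inv, FreeGroup.lift_apply_of, mul_inv_eq_one]
  · exact Subtype.ext (trefM₂_mul_Amat a b c)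
  · exact Subtype.ext (Amat_mul_trefM₃ a b c)

/-- For every `a, b, c ∈ ℤ`, the matrices `M₁ = A`, `M₂`, `M₃` lie in `SL(3,ℤ)`, are
conjugate to `A`, satisfy the Wirtinger relations `M₂M₁ = M₁M₃ = M₃M₂`, and hence the
assignment `gᵢ ↦ Mᵢ` extends to a homomorphism `ρ_{abc} : G → SL(3,ℤ)` of the trefoil
group sending each generator into the conjugacy class of `A`. -/
theorem trefoil_M_homomorphisms (a b c : ℤ) :
    Amat.det = 1 ∧ (trefM₂ a b c).det = 1 ∧ (trefM₃ a b c).det = 1 ∧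
    ConjToA Amat ∧ ConjToA (trefM₂ a b c) ∧ ConjToA (trefM₃ a b c) ∧
    trefM₂ a b c * Amat = Amat * trefM₃ a b c ∧
    Amat * trefM₃ a b c = trefM₃ a b c * trefM₂ a b c ∧
    ∃ ρ : TrefoilGroup →* SL3,
      ((ρ (PresentedGroup.of 0) : SL3) : Matrix (Fin 3) (Fin 3) ℤ) = Amat ∧
      ((ρ (PresentedGroup.of 1) : SL3) : Matrix (Fin 3) (Fin 3) ℤ) = trefM₂ a b c ∧
      ((ρ (PresentedGroup.of 2) : SL3) : Matrix (Fin 3) (Fin 3) ℤ) = trefM₃ a b c ∧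
      ∀ i : Fin 3, ConjToA ((ρ (PresentedGroup.of i) : SL3) : Matrix (Fin 3) (Fin 3) ℤ) := by
  refine ⟨det_Amat, det_trefM₂ a b c, det_trefM₃ a b c, conjToA_Amat, conjToA_trefM₂ a b c,
    conjToA_trefM₃ a b c, trefM₂_mul_Amat a b c, Amat_mul_trefM₃ a b c,
    PresentedGroup.toGroup (lift_trefoilGen_eq_one a b c), ?_⟩
  simp only [PresentedGroup.toGroup.of]
  refine ⟨rfl, rfl, rfl, fun i => ?_⟩
  fin_cases i
  · exact conjToA_Amat
  · exact conjToA_trefM₂ a b c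
  · exact conjToA_trefM₃ a b c
end

section
/- For a, b, c ∈ ℤ, let C = (1,a,c; 0,1,0; 0,b,1). Then det(C) = 1, C commutes with A, and C⁻¹ρ_{abc}(g_i)C = ρ₀₀₀(g_i) for i = 1, 2, 3; that is, conjugation by C transforms the homomorphism ρ_{abc} into ρ₀₀₀, so all the homomorphisms ρ_{abc} are conjugate to ρ₀₀₀. -/
open Matrix

/-- The conjugating matrix `C = (1,a,c; 0,1,0; 0,b,1)`. -/
def Cmat (a b c : ℤ) : Matrix (Fin 3) (Fin 3) ℤ := !![1, a, c; 0, 1, 0; 0, b, 1]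

lemma det_Cmat (a b c : ℤ) : (Cmat a b c).det = 1 := by
  simp [Cmat, Matrix.det_fin_three]

lemma Cmat_mul_Amat (a b c : ℤ) : Cmat a b c * Amat = Amat * Cmat a b c := by
  ext i j
  fin_cases i <;> fin_cases j <;>
    simp [Cmat, Amat, Matrix.mul_apply, Fin.sum_univ_three]
  ring

lemma trefM₂_mul_Cmat (a b c : ℤ) :
    trefM₂ a b c * Cmat a b c = Cmat a b c * trefM₂ 0 0 0 := by
  ext i j
  fin_cases i <;> fin_cases j <;>
    simp [Cmat, trefM₂, Matrix.mul_apply, Fin.sum_univ_three] <;> ring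

lemma trefM₃_mul_Cmat (a b c : ℤ) :
    trefM₃ a b c * Cmat a b c = Cmat a b c * trefM₃ 0 0 0 := by
  ext i j
  fin_cases i <;> fin_cases j <;>
    simp [Cmat, trefM₃, Matrix.mul_apply, Fin.sum_univ_three] <;> ring

lemma inv_Cmat_mul_mul_eq {a b c : ℤ} {M N : Matrix (Fin 3) (Fin 3) ℤ}
    (h : M * Cmat a b c = Cmat a b c * N) : (Cmat a b c)⁻¹ * M * Cmat a b c = N := by
  rw [Matrix.mul_assoc, h, Matrix.nonsing_inv_mul_cancel_left _ _ (by simp [det_Cmat])]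

/-- `C` has determinant `1`, commutes with `A`, and conjugation by `C` transforms the
values of `ρ_{abc}` on the generators into those of `ρ₀₀₀`; hence every homomorphism
`ρ_{abc}` is conjugate to `ρ₀₀₀`. -/
theorem trefoil_M_homomorphisms_conjugate (a b c : ℤ) :
    (Cmat a b c).det = 1 ∧
    Cmat a b c * Amat = Amat * Cmat a b c ∧
    (Cmat a b c)⁻¹ * Amat * Cmat a b c = Amat ∧
    (Cmat a b c)⁻¹ * trefM₂ a b c * Cmat a b c = trefM₂ 0 0 0 ∧
    (Cmat a b c)⁻¹ * trefM₃ a b c * Cmat a b c = trefM₃ 0 0 0 ∧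
    ∀ ρ ρ' : TrefoilGroup →* SL3,
      ((ρ (PresentedGroup.of 0) : SL3) : Matrix (Fin 3) (Fin 3) ℤ) = Amat →
      ((ρ (PresentedGroup.of 1) : SL3) : Matrix (Fin 3) (Fin 3) ℤ) = trefM₂ a b c →
      ((ρ (PresentedGroup.of 2) : SL3) : Matrix (Fin 3) (Fin 3) ℤ) = trefM₃ a b c →
      ((ρ' (PresentedGroup.of 0) : SL3) : Matrix (Fin 3) (Fin 3) ℤ) = Amat →
      ((ρ' (PresentedGroup.of 1) : SL3) : Matrix (Fin 3) (Fin 3) ℤ) = trefM₂ 0 0 0 →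
      ((ρ' (PresentedGroup.of 2) : SL3) : Matrix (Fin 3) (Fin 3) ℤ) = trefM₃ 0 0 0 →
      ∀ g : TrefoilGroup,
        ((ρ' g : SL3) : Matrix (Fin 3) (Fin 3) ℤ) =
          (Cmat a b c)⁻¹ * ((ρ g : SL3) : Matrix (Fin 3) (Fin 3) ℤ) * Cmat a b c := by
  refine ⟨det_Cmat a b c, Cmat_mul_Amat a b c, inv_Cmat_mul_mul_eq (Cmat_mul_Amat a b c).symm,
    inv_Cmat_mul_mul_eq (trefM₂_mul_Cmat a b c), inv_Cmat_mul_mul_eq (trefM₃_mul_Cmat a b c), ?_⟩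
  intro ρ ρ' h₀ h₁ h₂ h₀' h₁' h₂' g
  let C : SL3 := ⟨Cmat a b c, det_Cmat a b c⟩
  have hρ : ρ' = (MulAut.conj C⁻¹).toMonoidHom.comp ρ := by
    refine PresentedGroup.ext fun i => ?_
    suffices h : ρ (PresentedGroup.of i) * C = C * ρ' (PresentedGroup.of i) by
      simp [mul_assoc, h]
    apply Subtype.ext
    rw [Matrix.SpecialLinearGroup.coe_mul, Matrix.SpecialLinearGroup.coe_mul]
    match i with
    | 0 => rw [h₀, h₀']; exact (Cmat_mul_Amat a b c).symm
    | 1 => rw [h₁, h₁']; exact trefM₂_mul_Cmat a b c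
    | 2 => rw [h₂, h₂']; exact trefM₃_mul_Cmat a b c
  refine (inv_Cmat_mul_mul_eq ?_).symm
  have h : ρ g * C = C * ρ' g := by simp [hρ, mul_assoc]
  exact congrArg Subtype.val h
end

section
/- Let ρ: G → SL(3,ℤ) be a group homomorphism from the trefoil group G such that each of ρ(g₁), ρ(g₂), ρ(g₃) is conjugate in SL(3,ℤ) to A. Then there exists M ∈ SL(3,ℤ) such that either M⁻¹ρ(g_i)M = A for all i = 1, 2, 3 (the trivial M-representation, which factors through the abelianization G^{ab} ≅ ℤ), or M⁻¹ρ(g_i)M = ρ₀₀₀(g_i) for all i = 1, 2, 3. In other words, up to conjugation the trefoil group has exactly one trivial and one non-trivial M-representation. -/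
open Matrix

/-- `ρ₀₀₀(g₂) = (1,0,0; −1,1,0; 0,0,1)`. -/
def rho000M₂ : Matrix (Fin 3) (Fin 3) ℤ := !![1, 0, 0; -1, 1, 0; 0, 0, 1]

/-- `ρ₀₀₀(g₃) = (2,1,0; −1,0,0; 0,0,1)`. -/
def rho000M₃ : Matrix (Fin 3) (Fin 3) ℤ := !![2, 1, 0; -1, 0, 0; 0, 0, 1]

/-- A matrix conjugate to `A` is a transvection `1 + v ψᵀ` with `ψ ⬝ v = 0`. -/
theorem ConjToA.exists_eq_one_add_vecMulVec {B : Matrix (Fin 3) (Fin 3) ℤ} (h : ConjToA B) :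
    ∃ v p : Fin 3 → ℤ, p ⬝ᵥ v = 0 ∧ B = 1 + vecMulVec v p := by
  obtain ⟨P, hP⟩ := h
  have h₁ : P.val * P⁻¹.val = 1 := congrArg Subtype.val (mul_inv_cancel P)
  have h₂ : P⁻¹.val * P.val = 1 := congrArg Subtype.val (inv_mul_cancel P)
  generalize P.val = X at *
  generalize P⁻¹.val = Y at *
  have hA : Amat = 1 + vecMulVec ![1, 0, 0] ![0, 1, 0] := by decide
  refine ⟨X *ᵥ ![1, 0, 0], ![0, 1, 0] ᵥ* Y, ?_, ?_⟩
  · rw [← dotProduct_mulVec, mulVec_mulVec, h₂, one_mulVec]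
    simp
  · calc B = (X * Y) * B * (X * Y) := by rw [h₁]; simp
      _ = X * (Y * B * X) * Y := by simp only [Matrix.mul_assoc]
      _ = _ := by
        rw [hP, hA, Matrix.mul_add, Matrix.add_mul, Matrix.mul_one, h₁, mul_vecMulVec,
          vecMulVec_mul]

/-- Two transvections satisfying the braid relation are equal, or the product of the two
mixed pairings is `-1`. -/
theorem vecMulVec_eq_or_of_braid {n : Type*} [Fintype n] [DecidableEq n] {u f v p : n → ℤ}
    (hu : f ⬝ᵥ u = 0) (hv : p ⬝ᵥ v = 0)
    (h : (1 + vecMulVec u f) * (1 + vecMulVec v p) * (1 + vecMulVec u f) =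
      (1 + vecMulVec v p) * (1 + vecMulVec u f) * (1 + vecMulVec v p)) :
    vecMulVec v p = vecMulVec u f ∨ (f ⬝ᵥ v) * (p ⬝ᵥ u) = -1 := by
  have h₁ : vecMulVec u f * vecMulVec u f = 0 := by simp [vecMulVec_mul_vecMulVec, hu]
  have h₂ : vecMulVec v p * vecMulVec v p = 0 := by simp [vecMulVec_mul_vecMulVec, hv]
  have h₃ : vecMulVec u f * vecMulVec v p * vecMulVec u f =
      ((f ⬝ᵥ v) * (p ⬝ᵥ u)) • vecMulVec u f := by
    rw [vecMulVec_mul_vecMulVec, vecMulVec_mul_vecMulVec, smul_dotProduct, vecMulVec_smul,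
      smul_eq_mul]
  have h₄ : vecMulVec v p * vecMulVec u f * vecMulVec v p =
      ((f ⬝ᵥ v) * (p ⬝ᵥ u)) • vecMulVec v p := by
    rw [vecMulVec_mul_vecMulVec, vecMulVec_mul_vecMulVec, smul_dotProduct, vecMulVec_smul,
      smul_eq_mul, mul_comm]
  generalize vecMulVec u f = N at *
  generalize vecMulVec v p = L at *
  generalize (f ⬝ᵥ v) * (p ⬝ᵥ u) = t at *
  have key : (1 + t) • (L - N) = 0 := by
    have e₁ : (1 + N) * (1 + L) * (1 + N) =
        1 + N + N + L + N * L + L * N + N * N + N * L * N := by noncomm_ring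
    have e₂ : (1 + L) * (1 + N) * (1 + L) =
        1 + L + L + N + N * L + L * N + L * L + L * N * L := by noncomm_ring
    rw [e₁, e₂, h₁, h₂, h₃, h₄, ← sub_eq_zero] at h
    rw [← neg_eq_zero, ← h]
    module
  rcases smul_eq_zero.mp key with ht | hNL
  · right; linarith
  · left; exact sub_eq_zero.mp hNL

/-- A transvection in braid relation with `A` is `A` itself or is simultaneously conjugate,
by an element centralizing `A`, to `ρ₀₀₀(g₂)`. -/
theorem ConjToA.eq_or_exists_of_braid {B : Matrix (Fin 3) (Fin 3) ℤ} (h : ConjToA B)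
    (hb : Amat * B * Amat = B * Amat * B) :
    B = Amat ∨ ∃ M : SL3, Amat * (M : Matrix (Fin 3) (Fin 3) ℤ) = M * Amat ∧
      B * (M : Matrix (Fin 3) (Fin 3) ℤ) = M * rho000M₂ := by
  obtain ⟨v, p, hpv, rfl⟩ := h.exists_eq_one_add_vecMulVec
  have hA : Amat = 1 + vecMulVec ![1, 0, 0] ![0, 1, 0] := by decide
  have hb' := hb
  rw [hA] at hb'
  rcases vecMulVec_eq_or_of_braid (by simp) hpv hb' with he | he
  · left; rw [he, hA]
  right
  have hpv' : p 0 * v 0 + p 1 * v 1 + p 2 * v 2 = 0 := by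
    simpa [dotProduct, Fin.sum_univ_three] using hpv
  have he' : v 1 * p 0 = -1 := by
    simpa [dotProduct, Fin.sum_univ_three] using he
  have hv1 : v 1 * v 1 = 1 := by
    rcases Int.eq_one_or_neg_one_of_mul_eq_neg_one he' with h | h <;> simp [h]
  have hp0 : p 0 = -v 1 := by linear_combination v 1 * he' - p 0 * hv1
  rw [hp0] at hpv'
  refine ⟨⟨!![1, v 1 * v 0, v 1 * p 2; 0, 1, 0; 0, v 1 * v 2, 1], by
    simp [det_fin_three]⟩, ?_, ?_⟩
  · ext i j
    fin_cases i <;> fin_cases j <;> simp [Amat, mul_apply, Fin.sum_univ_three, add_comm]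
  · ext i j
    fin_cases i <;> fin_cases j <;>
      simp [rho000M₂, mul_apply, Fin.sum_univ_three, vecMulVec_apply, one_apply, hp0] <;>
      grind

/-- Any homomorphism from the trefoil group to `SL(3,ℤ)` sending each generator into
the conjugacy class of `A` is conjugate either to the trivial `M`-representation
(all generators mapped to `A`) or to the non-trivial `M`-representation `ρ₀₀₀`. -/
theorem trefoil_M_representation_classification (ρ : TrefoilGroup →* SL3)
    (h : ∀ i : Fin 3, ConjToA ((ρ (PresentedGroup.of i) : SL3) : Matrix (Fin 3) (Fin 3) ℤ)) :
    ∃ M : SL3,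
      (∀ i : Fin 3,
        ((M⁻¹ * ρ (PresentedGroup.of i) * M : SL3) : Matrix (Fin 3) (Fin 3) ℤ) = Amat) ∨
      (((M⁻¹ * ρ (PresentedGroup.of 0) * M : SL3) : Matrix (Fin 3) (Fin 3) ℤ) = Amat ∧
       ((M⁻¹ * ρ (PresentedGroup.of 1) * M : SL3) : Matrix (Fin 3) (Fin 3) ℤ) = rho000M₂ ∧
       ((M⁻¹ * ρ (PresentedGroup.of 2) * M : SL3) : Matrix (Fin 3) (Fin 3) ℤ) = rho000M₃) := by
  have r₁ : ρ (.of 1) * ρ (.of 0) = ρ (.of 0) * ρ (.of 2) := by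
    simp only [← map_mul]
    exact congrArg ρ (PresentedGroup.mk_eq_mk_of_mul_inv_mem (Set.mem_insert _ _))
  have r₂ : ρ (.of 0) * ρ (.of 2) = ρ (.of 2) * ρ (.of 1) := by
    simp only [← map_mul]
    exact congrArg ρ (PresentedGroup.mk_eq_mk_of_mul_inv_mem
      (Set.mem_insert_of_mem _ (Set.mem_singleton _)))
  have h₀ := h 0
  have h₁ := h 1
  clear h
  have r₃ : ρ (.of 2) = (ρ (.of 0))⁻¹ * ρ (.of 1) * ρ (.of 0) := by
    rw [mul_assoc, r₁, inv_mul_cancel_left]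
  have hbraid : ρ (.of 0) * ρ (.of 1) * ρ (.of 0) = ρ (.of 1) * ρ (.of 0) * ρ (.of 1) := by
    calc _ = ρ (.of 0) * (ρ (.of 1) * ρ (.of 0)) := mul_assoc _ _ _
      _ = ρ (.of 0) * ρ (.of 2) * ρ (.of 1) := by rw [r₁, mul_assoc, r₂]
      _ = _ := by rw [r₁]
  clear r₁ r₂
  have hall (M : SL3) (hM : ((M⁻¹ * ρ (.of 0) * M : SL3)).val = Amat)
      (h' : ρ (.of 1) = ρ (.of 0)) (i : Fin 3) : (M⁻¹ * ρ (.of i) * M).val = Amat := by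
    fin_cases i
    · exact hM
    · exact h' ▸ hM
    · simpa [r₃, h'] using hM
  generalize ρ (.of 0) = a at *
  generalize ρ (.of 1) = b at *
  generalize ρ (.of 2) = c at *
  subst r₃
  obtain ⟨P, hP⟩ := h₀
  have hbP : ConjToA (P⁻¹ * b * P).val := by
    obtain ⟨Q, hQ⟩ := h₁
    refine ⟨P⁻¹ * Q, ?_⟩
    rw [← hQ]
    change (((P⁻¹ * Q)⁻¹ * (P⁻¹ * b * P) * (P⁻¹ * Q) : SL3)).val = (Q⁻¹ * b * Q : SL3).val
    group
  have hP' : (P⁻¹ * a * P).val = Amat := hP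
  have hbr : Amat * (P⁻¹ * b * P).val * Amat =
      (P⁻¹ * b * P).val * Amat * (P⁻¹ * b * P).val := by
    rw [← hP']
    refine congrArg Subtype.val (?_ : P⁻¹ * a * P * (P⁻¹ * b * P) * (P⁻¹ * a * P) =
      P⁻¹ * b * P * (P⁻¹ * a * P) * (P⁻¹ * b * P))
    calc _ = P⁻¹ * (a * b * a) * P := by group
      _ = _ := by rw [hbraid]; group
  rcases hbP.eq_or_exists_of_braid hbr with hb | ⟨M, hM₁, hM₂⟩
  · have hab : b = a := by
      have : P⁻¹ * b * P = P⁻¹ * a * P := Subtype.ext (hb.trans hP'.symm)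
      simpa using this
    exact ⟨P, .inl (hall P hP' hab)⟩
  · let A₂ : SL3 := ⟨rho000M₂, by decide⟩
    have e₁ : (P * M)⁻¹ * a * (P * M) = P⁻¹ * a * P := by
      have : P⁻¹ * a * P * M = M * (P⁻¹ * a * P) := Subtype.ext (by
        change (P⁻¹ * a * P).val * M.val = M.val * (P⁻¹ * a * P).val
        rw [hP', hM₁])
      calc _ = M⁻¹ * (P⁻¹ * a * P * M) := by group
        _ = _ := by rw [this, inv_mul_cancel_left]
    have e₂ : (P * M)⁻¹ * b * (P * M) = A₂ := by
      have : P⁻¹ * b * P * M = M * A₂ := Subtype.ext hM₂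
      calc _ = M⁻¹ * (P⁻¹ * b * P * M) := by group
        _ = _ := by rw [this, inv_mul_cancel_left]
    have e₃ : (P * M)⁻¹ * (a⁻¹ * b * a) * (P * M) =
        (P⁻¹ * a * P)⁻¹ * A₂ * (P⁻¹ * a * P) := by
      rw [← e₁, ← e₂]; group
    refine ⟨P * M, .inr ⟨?_, ?_, ?_⟩⟩
    · exact (congrArg Subtype.val e₁).trans hP'
    · exact congrArg Subtype.val e₂
    · let A₁ : SL3 := ⟨Amat, by decide⟩
      have hA₁ : P⁻¹ * a * P = A₁ := Subtype.ext hP'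
      rw [hA₁] at e₃
      let A₃ : SL3 := ⟨rho000M₃, by decide⟩
      have e₄ : A₁⁻¹ * A₂ * A₁ = A₃ := by
        have : A₂ * A₁ = A₁ * A₃ :=
          Subtype.ext (show rho000M₂ * Amat = Amat * rho000M₃ by decide)
        rw [mul_assoc, this, inv_mul_cancel_left]
      exact congrArg Subtype.val (e₃.trans e₄)
end

section
/- Let η, ξ ∈ ℤ³ be primitive vectors with ⟨η,ξ⟩ = 0 satisfying the two equations (1+ξ₁)η = (1+ξ₁η₂)e₁ and (1−η₂)ξ = (1+ξ₁η₂)e₂, where e₁, e₂ are the first two standard basis vectors. Then either (η,ξ) = (e₁,e₂), or else ξ₁ = −1, η₂ = 1, and η₁ = ξ₂ + η₃ξ₃ (so that η = (a,1,b) and ξ = (−1, a−bc, c) for some a, b, c ∈ ℤ). -/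
open Matrix

/-- A vector of `ℤ³` is primitive if the gcd of its entries is `1`. -/
def Primitive (v : Fin 3 → ℤ) : Prop := Int.gcd (Int.gcd (v 0) (v 1)) (v 2) = 1

/-- The standard bilinear form on `ℤ³`. -/
def dot3 (η ξ : Fin 3 → ℤ) : ℤ := η 0 * ξ 0 + η 1 * ξ 1 + η 2 * ξ 2

/-- Solutions of the equations `(1+ξ₁)η = (1+ξ₁η₂)e₁` and `(1−η₂)ξ = (1+ξ₁η₂)e₂` for
primitive orthogonal `η, ξ ∈ ℤ³`: either `(η,ξ) = (e₁,e₂)`, or `ξ₁ = −1`, `η₂ = 1` and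
`η₁ = ξ₂ + η₃ξ₃`. -/
theorem trefoil_wirtinger_equations (η ξ : Fin 3 → ℤ)
    (hη : Primitive η) (hξ : Primitive ξ) (hd : dot3 η ξ = 0)
    (h1 : (1 + ξ 0) • η = (1 + ξ 0 * η 1) • (![1, 0, 0] : Fin 3 → ℤ))
    (h2 : (1 - η 1) • ξ = (1 + ξ 0 * η 1) • (![0, 1, 0] : Fin 3 → ℤ)) :
    (η = ![1, 0, 0] ∧ ξ = ![0, 1, 0]) ∨
    (ξ 0 = -1 ∧ η 1 = 1 ∧ η 0 = ξ 1 + η 2 * ξ 2) := by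
  have a0 := congrFun h1 0
  have a1 := congrFun h1 1
  have a2 := congrFun h1 2
  have b0 := congrFun h2 0
  have b1 := congrFun h2 1
  have b2 := congrFun h2 2
  simp only [Pi.smul_apply, smul_eq_mul, cons_val, mul_one, mul_zero] at a0 a1 a2 b0 b1 b2
  by_cases hx : 1 + ξ 0 = 0
  · have hx' : ξ 0 = -1 := by omega
    have hq : η 1 = 1 := by
      rw [hx'] at a0
      linarith
    rw [dot3, hx', hq] at hd
    exact Or.inr ⟨hx', hq, by linarith⟩
  · have hq : η 1 = 0 := (mul_eq_zero.mp a1).resolve_left hx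
    have hc : η 2 = 0 := (mul_eq_zero.mp a2).resolve_left hx
    have hx0 : ξ 0 = 0 := by simpa [hq] using b0
    have hy : ξ 1 = 1 := by simpa [hq] using b1
    have hz : ξ 2 = 0 := by simpa [hq] using b2
    have ha : η 0 = 1 := by simpa [hx0] using a0
    refine Or.inl ⟨?_, ?_⟩ <;> ext i <;> fin_cases i <;> simp [*]
end

section
/- Let M = (1,1; 0,1) and L = (−1,6; 0,−1) in SL(2,ℤ), which commute. Define D = {(μ,λ) ∈ ℤ² × ℤ² : (M−Id)λ = (L−Id)μ} (the derivations of the induced representation of the free abelian group ⟨m,ℓ⟩ ≅ ℤ²) and P = {((M−Id)κ, (L−Id)κ) : κ ∈ ℤ²} (the principal derivations). Then D = {((r,0),(t,−2r)) : r, t ∈ ℤ}, so D ≅ ℤ² as a group; P is the subgroup of D corresponding to pairs with t even; and the quotient D/P is isomorphic to ℤ/2. (Hence H¹(G',ρ') ≅ ℤ/2 for G' = ⟨m,ℓ⟩.) -/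
open Matrix

/-- `M = (1,1; 0,1)`, the image of a meridian of the trefoil. -/
def Mmer : Matrix (Fin 2) (Fin 2) ℤ := !![1, 1; 0, 1]

/-- `L = (−1,6; 0,−1)`, the image of a longitude of the trefoil. -/
def Llong : Matrix (Fin 2) (Fin 2) ℤ := !![-1, 6; 0, -1]

/-- Derivations: pairs `(μ,λ)` with `(M−Id)λ = (L−Id)μ`, realized as the kernel of
`(μ,λ) ↦ (M−Id)λ − (L−Id)μ`. -/
def derSub : Submodule ℤ ((Fin 2 → ℤ) × (Fin 2 → ℤ)) :=
  LinearMap.ker ((Mmer - 1).mulVecLin ∘ₗ LinearMap.snd ℤ (Fin 2 → ℤ) (Fin 2 → ℤ) -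
    (Llong - 1).mulVecLin ∘ₗ LinearMap.fst ℤ (Fin 2 → ℤ) (Fin 2 → ℤ))

/-- Principal derivations: pairs `((M−Id)κ, (L−Id)κ)` for `κ ∈ ℤ²`. -/
def prinSub : Submodule ℤ ((Fin 2 → ℤ) × (Fin 2 → ℤ)) :=
  LinearMap.range (LinearMap.prod (Mmer - 1).mulVecLin (Llong - 1).mulVecLin)

theorem Mmer_sub_one_mulVec (v : Fin 2 → ℤ) : (Mmer - 1) *ᵥ v = ![v 1, 0] := by
  ext i
  fin_cases i <;> simp [Mmer, mulVec, dotProduct, Fin.sum_univ_two]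

theorem Llong_sub_one_mulVec (v : Fin 2 → ℤ) :
    (Llong - 1) *ᵥ v = ![-2 * v 0 + 6 * v 1, -2 * v 1] := by
  ext i
  fin_cases i <;> simp [Llong, mulVec, dotProduct, Fin.sum_univ_two]

theorem mem_derSub_iff {p : (Fin 2 → ℤ) × (Fin 2 → ℤ)} :
    p ∈ derSub ↔ p.1 1 = 0 ∧ p.2 1 = -2 * p.1 0 := by
  simp only [derSub, LinearMap.mem_ker, LinearMap.sub_apply, LinearMap.comp_apply,
    LinearMap.fst_apply, LinearMap.snd_apply, mulVecLin_apply, Mmer_sub_one_mulVec,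
    Llong_sub_one_mulVec, sub_eq_zero, funext_iff, Fin.forall_fin_two, cons_val_zero, cons_val_one]
  omega

theorem mem_prinSub_iff {p : (Fin 2 → ℤ) × (Fin 2 → ℤ)} :
    p ∈ prinSub ↔ Even (p.2 0) ∧ p.1 1 = 0 ∧ p.2 1 = -2 * p.1 0 := by
  simp only [prinSub, LinearMap.mem_range, LinearMap.prod_apply, Function.prod, Prod.ext_iff,
    mulVecLin_apply, Mmer_sub_one_mulVec, Llong_sub_one_mulVec, funext_iff, Fin.forall_fin_two,
    cons_val_zero, cons_val_one]
  constructor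
  · rintro ⟨k, ⟨h1, h2⟩, h3, h4⟩
    exact ⟨⟨-k 0 + 3 * k 1, by omega⟩, by omega, by omega⟩
  · rintro ⟨⟨c, hc⟩, h1, h2⟩
    refine ⟨![3 * p.1 0 - c, p.1 0], ⟨rfl, h1.symm⟩, ?_, h2.symm⟩
    rw [cons_val_zero, cons_val_one, cons_val_zero]
    omega

theorem eq_pair_iff {p : (Fin 2 → ℤ) × (Fin 2 → ℤ)} {r t : ℤ} :
    p = (![r, 0], ![t, -2 * r]) ↔
      p.1 0 = r ∧ p.1 1 = 0 ∧ p.2 0 = t ∧ p.2 1 = -2 * r := by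
  simp [Prod.ext_iff, funext_iff, Fin.forall_fin_two, and_assoc]

/-- The coordinates `(r, t)` of the derivation `((r,0),(t,−2r))`. -/
def derSubEquiv : derSub ≃+ (ℤ × ℤ) where
  toFun p := (p.1.1 0, p.1.2 0)
  invFun q := ⟨(![q.1, 0], ![q.2, -2 * q.1]), mem_derSub_iff.2 (by simp)⟩
  left_inv p := by
    have hp := mem_derSub_iff.1 p.2
    exact Subtype.ext (eq_pair_iff.2 ⟨rfl, hp.1, rfl, hp.2⟩).symm
  right_inv q := by simp
  map_add' p q := by simp

/-- The class in `ℤ/2` of the coordinate `t` of the derivation `((r,0),(t,−2r))`. -/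
def derSubParity : derSub →ₗ[ℤ] ZMod 2 :=
  ((Int.castAddHom (ZMod 2)).comp
    ((AddMonoidHom.snd ℤ ℤ).comp derSubEquiv.toAddMonoidHom)).toIntLinearMap

theorem derSubParity_apply (p : derSub) : derSubParity p = ((p.1.2 0 : ℤ) : ZMod 2) := rfl

theorem derSubParity_surjective : Function.Surjective derSubParity := fun z => by
  obtain ⟨t, rfl⟩ := ZMod.intCast_surjective z
  exact ⟨derSubEquiv.symm (0, t), rfl⟩

theorem comap_prinSub_eq_ker : prinSub.comap derSub.subtype = LinearMap.ker derSubParity := by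
  ext p
  rw [Submodule.mem_comap, LinearMap.mem_ker, derSubParity_apply, Submodule.subtype_apply,
    ZMod.intCast_eq_zero_iff_even, mem_prinSub_iff]
  exact and_iff_left (mem_derSub_iff.1 p.2)

/-- `M` and `L` commute; the derivations are exactly the pairs `((r,0),(t,−2r))`, so
`D ≅ ℤ²`; the principal derivations are the subgroup of those with `t` even; and the
quotient `D/P ≅ ℤ/2`, computing `H¹(G',ρ') ≅ ℤ/2` for `G' = ⟨m,ℓ⟩`. -/
theorem trefoil_first_cohomology :
    Mmer * Llong = Llong * Mmer ∧
    (derSub : Set ((Fin 2 → ℤ) × (Fin 2 → ℤ))) =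
      {p | ∃ r t : ℤ, p = (![r, 0], ![t, -2 * r])} ∧
    Nonempty (derSub ≃+ (ℤ × ℤ)) ∧
    prinSub ≤ derSub ∧
    (prinSub : Set ((Fin 2 → ℤ) × (Fin 2 → ℤ))) =
      {p | ∃ r t : ℤ, Even t ∧ p = (![r, 0], ![t, -2 * r])} ∧
    Nonempty ((derSub ⧸ prinSub.comap derSub.subtype) ≃+ ZMod 2) := by
  refine ⟨by decide, ?_, ⟨derSubEquiv⟩, fun p hp => mem_derSub_iff.2 (mem_prinSub_iff.1 hp).2,
    ?_, ?_⟩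
  · ext p
    simp only [SetLike.mem_coe, Set.mem_ofPred_eq, mem_derSub_iff, eq_pair_iff]
    grind
  · ext p
    simp only [SetLike.mem_coe, Set.mem_ofPred_eq, mem_prinSub_iff, eq_pair_iff]
    grind
  · exact ⟨((Submodule.quotEquivOfEq _ _ comap_prinSub_eq_ker).trans
      (derSubParity.quotKerEquivOfSurjective derSubParity_surjective)).toAddEquiv⟩
end
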